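/- Let d ≥ 3 and let ℋ = ℂ^d. For every nonempty measurable space Λ there is no map ε assigning to every Hermitian d×d complex matrix O a measurable function ε(O) : Λ → ℝ such that ε(g(O)) = g ∘ ε(O) for every Hermitian O and every function g : ℝ → ℝ. That is, the full set of quantum observables on a Hilbert space of dimension at least 3 admits no classical embedding satisfying the Kochen–Specker noncontextuality condition. -/

import Mathlib

open Matrix

/-- A two-valued function on the projections of a star ring that is additive on orthogonal
projections. -/
structure IsProjectionValuation {R : Type*} [Ring R] [StarRing R] (w : R → ℝ) : Prop where
  zero_or_one : ∀ P, IsStarProjection P → w P = 0 ∨ w P = 1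
  map_add : ∀ P Q, IsStarProjection P → IsStarProjection Q → P * Q = 0 → w (P + Q) = w P + w Q

namespace IsProjectionValuation

section Ring

variable {R S : Type*} [Ring R] [StarRing R] [Ring S] [StarRing S] {w : R → ℝ}

lemma nonneg (hw : IsProjectionValuation w) {P : R} (hP : IsStarProjection P) : 0 ≤ w P := by
  rcases hw.zero_or_one P hP with h | h <;> simp [h]

lemma le_one (hw : IsProjectionValuation w) {P : R} (hP : IsStarProjection P) : w P ≤ 1 := by
  rcases hw.zero_or_one P hP with h | h <;> simp [h]

lemma map_zero (hw : IsProjectionValuation w) : w 0 = 0 := by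
  simpa using hw.map_add 0 0 (.zero R) (.zero R) (by simp)

lemma comp (hw : IsProjectionValuation w) (φ : S →⋆ₙ+* R) :
    IsProjectionValuation (w ∘ φ) where
  zero_or_one P hP := hw.zero_or_one _ (hP.map φ)
  map_add P Q hP hQ h := by
    simpa using hw.map_add _ _ (hP.map φ) (hQ.map φ) (by rw [← _root_.map_mul, h, _root_.map_zero])

lemma map_sum (hw : IsProjectionValuation w) {ι : Type*} (s : Finset ι) (p : ι → R)
    (hp : ∀ i, IsStarProjection (p i)) (hpq : Pairwise fun i j ↦ p i * p j = 0) :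
    IsStarProjection (∑ i ∈ s, p i) ∧ w (∑ i ∈ s, p i) = ∑ i ∈ s, w (p i) := by
  classical
  induction s using Finset.induction_on with
  | empty => simp [hw.map_zero, IsStarProjection.zero]
  | insert a s ha ih =>
    have h : p a * ∑ i ∈ s, p i = 0 := by
      rw [Finset.mul_sum]
      exact Finset.sum_eq_zero fun i hi ↦ hpq fun hai ↦ ha (hai ▸ hi)
    rw [Finset.sum_insert ha, Finset.sum_insert ha]
    exact ⟨(hp a).add ih.1 h, by rw [hw.map_add _ _ (hp a) ih.1 h, ih.2]⟩

end Ring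

end IsProjectionValuation

/-- Additivity is forced by evaluating polynomials in `P + 2 Q`. -/
lemma isProjectionValuation_of_aeval {R : Type*} [Ring R] [StarRing R] [Algebra ℝ R]
    {w : R → ℝ} (hw : ∀ O : R, IsSelfAdjoint O → ∀ q : Polynomial ℝ,
      w (Polynomial.aeval O q) = q.eval (w O)) : IsProjectionValuation w where
  zero_or_one P hP := by
    have h := hw P hP.isSelfAdjoint (Polynomial.X * Polynomial.X)
    have hPP : P * P = P := hP.isIdempotentElem
    simp only [_root_.map_mul, Polynomial.aeval_X, hPP, Polynomial.eval_mul,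
      Polynomial.eval_X] at h
    have : w P * (w P - 1) = 0 := by linarith
    rcases mul_eq_zero.mp this with h | h
    · exact .inl h
    · exact .inr (by linarith)
  map_add P Q hP hQ hPQ := by
    have hPP : P * P = P := hP.isIdempotentElem
    have hQQ : Q * Q = Q := hQ.isIdempotentElem
    have hQP : Q * P = 0 := by
      simpa [hP.isSelfAdjoint.star_eq, hQ.isSelfAdjoint.star_eq] using congrArg star hPQ
    set A : R := P + (Q + Q) with hA
    have hAs : IsSelfAdjoint A := hP.isSelfAdjoint.add (hQ.isSelfAdjoint.add hQ.isSelfAdjoint)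
    have hAA : A * A = P + (Q + Q + Q + Q) := by
      simp only [hA, mul_add, add_mul, hPP, hQQ, hPQ, hQP]
      abel
    have key (a b : ℝ) : w (a • A + b • (A * A)) = a * w A + b * (w A * w A) := by
      have h := hw A hAs (a • Polynomial.X + b • (Polynomial.X * Polynomial.X))
      simpa using h
    have h₁ : (2 : ℝ) • A + (-1 : ℝ) • (A * A) = P := by rw [hAA, hA]; module
    have h₂ : (-1 / 2 : ℝ) • A + (1 / 2 : ℝ) • (A * A) = Q := by rw [hAA, hA]; module
    have h₃ : (3 / 2 : ℝ) • A + (-1 / 2 : ℝ) • (A * A) = P + Q := by rw [hAA, hA]; module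
    have k₁ := key 2 (-1)
    have k₂ := key (-1 / 2) (1 / 2)
    have k₃ := key (3 / 2) (-1 / 2)
    rw [h₁] at k₁
    rw [h₂] at k₂
    rw [h₃] at k₃
    rw [k₁, k₂, k₃]
    ring

/-- Three nonzero pairwise orthogonal integer vectors. -/
abbrev IsOrthogonalTriple (u v t : Fin 3 → ℤ) : Prop :=
  (u ≠ 0 ∧ v ≠ 0 ∧ t ≠ 0) ∧ u ⬝ᵥ v = 0 ∧ u ⬝ᵥ t = 0 ∧ v ⬝ᵥ t = 0

/-- Vectors at angle `π / 4` cannot both have value `1`. -/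
lemma not_one_of_orthogonalTriple {f : (Fin 3 → ℤ) → ℝ} (hnonneg : ∀ u, 0 ≤ f u)
    (hsum : ∀ u v t, IsOrthogonalTriple u v t → f u + f v + f t = 1)
    (h₁ : f ![0, 0, 1] = 1) (h₂ : f ![0, 1, 1] = 1) : False := by
  have := hsum ![0, 1, 0] ![1, 0, 2] ![2, 0, -1] (by decide)
  have := hsum ![0, 0, 1] ![0, 1, 0] ![1, 0, 0] (by decide)
  have := hsum ![0, 1, 1] ![1, -1, 1] ![2, 1, -1] (by decide)
  have := hsum ![0, 1, 1] ![1, 1, -1] ![2, -1, 1] (by decide)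
  have := hsum ![1, 0, 2] ![2, -1, -1] ![2, 5, -1] (by decide)
  have := hsum ![0, 1, -1] ![0, 1, 1] ![1, 0, 0] (by decide)
  have := hsum ![0, 2, 1] ![1, -1, 2] ![5, 1, -2] (by decide)
  have := hsum ![1, -1, -1] ![1, -1, 2] ![1, 1, 0] (by decide)
  have := hsum ![0, 1, 0] ![1, 0, -1] ![1, 0, 1] (by decide)
  have := hsum ![0, 1, -2] ![0, 2, 1] ![1, 0, 0] (by decide)
  have := hsum ![0, 0, 1] ![1, -1, 0] ![1, 1, 0] (by decide)
  have := hsum ![1, -1, 1] ![1, 0, -1] ![1, 2, 1] (by decide)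
  have := hsum ![1, -1, 0] ![1, 1, -1] ![1, 1, 2] (by decide)
  have := hsum ![0, 1, -1] ![1, 1, 1] ![2, -1, -1] (by decide)
  have := hsum ![1, -5, 2] ![1, 1, 2] ![2, 0, -1] (by decide)
  have := hsum ![1, -1, -1] ![1, 0, 1] ![1, 2, -1] (by decide)
  have := hsum ![0, 1, -2] ![1, 2, 1] ![5, -2, -1] (by decide)
  have := hsum ![1, -2, 1] ![1, 0, -1] ![1, 1, 1] (by decide)
  have := hnonneg ![0, 0, 1]
  have := hnonneg ![0, 1, -2]
  have := hnonneg ![0, 1, -1]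
  have := hnonneg ![0, 1, 0]
  have := hnonneg ![0, 1, 1]
  have := hnonneg ![0, 2, 1]
  have := hnonneg ![1, -5, 2]
  have := hnonneg ![1, -2, 1]
  have := hnonneg ![1, -1, -1]
  have := hnonneg ![1, -1, 0]
  have := hnonneg ![1, -1, 1]
  have := hnonneg ![1, -1, 2]
  have := hnonneg ![1, 0, -1]
  have := hnonneg ![1, 0, 0]
  have := hnonneg ![1, 0, 1]
  have := hnonneg ![1, 0, 2]
  have := hnonneg ![1, 1, -1]
  have := hnonneg ![1, 1, 0]
  have := hnonneg ![1, 1, 1]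
  have := hnonneg ![1, 1, 2]
  have := hnonneg ![1, 2, -1]
  have := hnonneg ![1, 2, 1]
  have := hnonneg ![2, -1, -1]
  have := hnonneg ![2, -1, 1]
  have := hnonneg ![2, 0, -1]
  have := hnonneg ![2, 1, -1]
  have := hnonneg ![2, 5, -1]
  have := hnonneg ![5, -2, -1]
  have := hnonneg ![5, 1, -2]
  linarith

/-- There is no two-valued function on the rays of `ℝ³` spanned by integer vectors taking the
value `1` exactly once on each orthogonal triple. -/
lemma no_colouring {f : (Fin 3 → ℤ) → ℝ} (hf : ∀ u, f u = 0 ∨ f u = 1)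
    (hsum : ∀ u v t, IsOrthogonalTriple u v t → f u + f v + f t = 1)
    (h₁ : f ![0, 0, 1] = 1) : False := by
  have hnonneg (u) : 0 ≤ f u := by rcases hf u with h | h <;> simp [h]
  rcases hf ![0, 1, 1] with h | h
  · let r (u : Fin 3 → ℤ) : Fin 3 → ℤ := ![u 0, -u 1, u 2]
    have hr (u v) : r u ⬝ᵥ r v = u ⬝ᵥ v := by simp [r, dotProduct, Fin.sum_univ_three]
    have hr₀ (u) (hu : u ≠ 0) : r u ≠ 0 := by
      rwa [Ne, ← dotProduct_self_eq_zero, hr, dotProduct_self_eq_zero]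
    have k₁ := hsum ![0, 0, 1] ![0, 1, 0] ![1, 0, 0] (by decide)
    have k₂ := hsum ![0, 1, 1] ![0, -1, 1] ![1, 0, 0] (by decide)
    refine not_one_of_orthogonalTriple (f := f ∘ r) (fun u ↦ hnonneg _) ?_ ?_ ?_
    · rintro u v t ⟨⟨hu, hv, ht⟩, h⟩
      exact hsum _ _ _ ⟨⟨hr₀ _ hu, hr₀ _ hv, hr₀ _ ht⟩, by simpa only [hr] using h⟩
    · simpa [r] using h₁
    · have : r ![0, 1, 1] = ![0, -1, 1] := by simp [r]
      rw [Function.comp_apply, this]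
      linarith [hnonneg ![0, 1, 0], hnonneg ![1, 0, 0]]
  · exact not_one_of_orthogonalTriple hnonneg hsum h₁ h

/-- The orthogonal projection onto the line spanned by a real vector. -/
noncomputable def lineProj {n : Type*} [Fintype n] (u : n → ℝ) : Matrix n n ℝ :=
  (u ⬝ᵥ u)⁻¹ • vecMulVec u u

section lineProj

variable {n : Type*} [Fintype n]

lemma lineProj_mul_lineProj_of_orthogonal {u v : n → ℝ} (h : u ⬝ᵥ v = 0) :
    lineProj u * lineProj v = 0 := by
  simp [lineProj, vecMulVec_mul_vecMulVec, h]

lemma isStarProjection_lineProj (u : n → ℝ) : IsStarProjection (lineProj u) where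
  isIdempotentElem := by
    rcases eq_or_ne u 0 with rfl | hu
    · simp [lineProj, IsIdempotentElem]
    · have h : u ⬝ᵥ u ≠ 0 := by rwa [Ne, dotProduct_self_eq_zero]
      simp [lineProj, IsIdempotentElem, vecMulVec_mul_vecMulVec, smul_smul, vecMulVec_smul, h]
  isSelfAdjoint := by
    simp [lineProj, IsSelfAdjoint, star_eq_conjTranspose]

/-- The projections onto the lines of an orthogonal basis sum to the identity. -/
lemma sum_lineProj [DecidableEq n] (b : n → n → ℝ) (hb : ∀ i, b i ≠ 0)
    (horth : Pairwise fun i j ↦ b i ⬝ᵥ b j = 0) : ∑ i, lineProj (b i) = 1 := by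
  have h : Matrix.of b * ((Matrix.of b)ᵀ * diagonal fun i ↦ (b i ⬝ᵥ b i)⁻¹) = 1 := by
    ext i j
    rw [← Matrix.mul_assoc, mul_diagonal]
    change (b i ⬝ᵥ b j) * _ = _
    rcases eq_or_ne i j with rfl | hij
    · rw [one_apply_eq, mul_inv_cancel₀]
      rw [Ne, dotProduct_self_eq_zero]
      exact hb i
    · rw [horth hij, one_apply_ne hij, zero_mul]
  rw [← mul_eq_one_comm.mp h]
  ext i j
  rw [Matrix.sum_apply, Matrix.mul_apply]
  refine Finset.sum_congr rfl fun k _ ↦ ?_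
  rw [mul_diagonal]
  simp only [lineProj, Matrix.smul_apply, vecMulVec_apply, transpose_apply, of_apply, smul_eq_mul]
  ring

end lineProj

lemma isStarProjection_single {n K : Type*} [Fintype n] [DecidableEq n] [CommRing K] [StarRing K]
    (i : n) : IsStarProjection (single i i (1 : K)) where
  isIdempotentElem := by simp [IsIdempotentElem]
  isSelfAdjoint := by simp [IsSelfAdjoint, star_eq_conjTranspose]

lemma IsProjectionValuation.map_one_eq_sum_single {n K : Type*} [Fintype n] [DecidableEq n]
    [CommRing K] [StarRing K] {w : Matrix n n K → ℝ} (hw : IsProjectionValuation w) :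
    w 1 = ∑ i, w (single i i 1) := by
  have h := (hw.map_sum Finset.univ (fun i ↦ single i i (1 : K)) isStarProjection_single
    fun i j hij ↦ single_mul_single_of_ne _ _ _ _ hij _).2
  rwa [sum_single_one] at h

/-- A valuation on the projections of `ℝ³` gives the value `1` to no coordinate axis. -/
lemma IsProjectionValuation.single_ne_one {w : Matrix (Fin 3) (Fin 3) ℝ → ℝ}
    (hw : IsProjectionValuation w) : w (single 2 2 1) ≠ 1 := by
  intro h₁
  have hone : w 1 = 1 := by
    refine le_antisymm (hw.le_one (.one _)) ?_
    refine h₁.ge.trans ?_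
    rw [hw.map_one_eq_sum_single]
    exact Finset.single_le_sum (f := fun i ↦ w (single i i 1))
      (fun i _ ↦ hw.nonneg (isStarProjection_single i)) (Finset.mem_univ 2)
  refine no_colouring (f := fun u ↦ w (lineProj fun i ↦ (u i : ℝ)))
    (fun u ↦ hw.zero_or_one _ (isStarProjection_lineProj _)) ?_ ?_
  · rintro u v t ⟨⟨hu, hv, ht⟩, huv, hut, hvt⟩
    have hcast (x y : Fin 3 → ℤ) (h : x ⬝ᵥ y = 0) :
        (fun i ↦ (x i : ℝ)) ⬝ᵥ (fun i ↦ (y i : ℝ)) = 0 := by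
      simp only [dotProduct] at h ⊢
      exact_mod_cast h
    have hcast₀ (x : Fin 3 → ℤ) (h : x ≠ 0) : (fun i ↦ (x i : ℝ)) ≠ 0 := fun h' ↦
      h (funext fun i ↦ by simpa using congrFun h' i)
    let b : Fin 3 → Fin 3 → ℝ := fun k i ↦ (![u, v, t] k i : ℝ)
    have horth : Pairwise fun i j ↦ b i ⬝ᵥ b j = 0 := by
      intro i j hij
      apply hcast
      fin_cases i <;> fin_cases j <;> simp_all [dotProduct_comm]
    have hb (i) : b i ≠ 0 := by
      apply hcast₀
      fin_cases i <;> simpa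
    have h := (hw.map_sum Finset.univ (fun i ↦ lineProj (b i))
      (fun i ↦ isStarProjection_lineProj _)
      fun i j hij ↦ lineProj_mul_lineProj_of_orthogonal (horth hij)).2
    rw [sum_lineProj b hb horth, hone, Fin.sum_univ_three] at h
    exact h.symm
  · rw [← h₁]
    congr 1
    ext i j
    fin_cases i <;> fin_cases j <;>
      simp [lineProj, dotProduct, Fin.sum_univ_three, vecMulVec_apply]

/-- Extension by zero of real `m × m` matrices to complex `n × n` matrices along `ι`. -/
noncomputable def extendByZero {m n : Type*} [Fintype m] [DecidableEq m] [Fintype n]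
    [DecidableEq n] (ι : m ↪ n) : Matrix m m ℝ →⋆ₙ+* Matrix n n ℂ where
  toFun X := (1 : Matrix n n ℂ).submatrix id ι * X.map Complex.ofRealHom *
    (1 : Matrix n n ℂ).submatrix ι id
  map_zero' := by simp
  map_add' X Y := by
    rw [Matrix.map_add _ (_root_.map_add _), Matrix.mul_add, Matrix.add_mul]
  map_mul' X Y := by
    have h : (1 : Matrix n n ℂ).submatrix ι id * (1 : Matrix n n ℂ).submatrix id ι = 1 := by
      rw [← submatrix_mul _ _ _ _ _ Function.bijective_id]
      simp
    simp only [Matrix.map_mul, Matrix.mul_assoc]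
    rw [← Matrix.mul_assoc (submatrix 1 ι id) (submatrix 1 id ι), h, Matrix.one_mul]
  map_star' X := by
    simp only [star_eq_conjTranspose, conjTranspose_mul, conjTranspose_submatrix,
      conjTranspose_one, Matrix.mul_assoc]
    congr 2
    ext i j
    simp

lemma extendByZero_single {m n : Type*} [Fintype m] [DecidableEq m] [Fintype n]
    [DecidableEq n] (ι : m ↪ n) (i : m) :
    extendByZero ι (single i i 1) = single (ι i) (ι i) 1 := by
  ext a b
  change ((1 : Matrix n n ℂ).submatrix id ι * (single i i 1).map Complex.ofRealHom *
    (1 : Matrix n n ℂ).submatrix ι id) a b = _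
  simp [Matrix.mul_apply, single_apply, one_apply, ite_and, eq_comm]
  rw [Finset.sum_eq_single i (fun x _ hx ↦ by simp [hx.symm]) (by simp)]
  by_cases ha : a = ι i <;> simp [ha]

/-- There is no valuation on the projections of `ℂᵈ`, `d ≥ 3`, with value `1` at the identity. -/
lemma IsProjectionValuation.map_one_ne_one {d : ℕ} (hd : 3 ≤ d)
    {w : Matrix (Fin d) (Fin d) ℂ → ℝ} (hw : IsProjectionValuation w) : w 1 ≠ 1 := by
  intro hone
  obtain ⟨i, hi⟩ : ∃ i, w (single i i 1) ≠ 0 := by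
    by_contra! h
    simp [hw.map_one_eq_sum_single, h] at hone
  have hi : w (single i i 1) = 1 := (hw.zero_or_one _ (isStarProjection_single i)).resolve_left hi
  let ι : Fin 3 ↪ Fin d := (Fin.castLEEmb hd).trans (Equiv.swap (Fin.castLE hd 2) i).toEmbedding
  have hι : ι 2 = i := by simp [ι]
  refine (hw.comp (extendByZero ι)).single_ne_one ?_
  rw [Function.comp_apply, extendByZero_single, hι, hi]

/-- Bell–Kochen–Specker theorem. For `d ≥ 3`, the full set of quantum
observables (Hermitian d×d complex matrices) admits no classical embedding satisfying the
Kochen–Specker noncontextuality condition: for every nonempty measurable space `Λ` there is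
no map `ε` assigning to every Hermitian `O` a measurable function `ε(O) : Λ → ℝ` with
`ε(g(O)) = g ∘ ε(O)` for every Hermitian `O` and every `g : ℝ → ℝ`, where
`g(O) = Σ_k g(λ_k) p_k` is the functional calculus. -/
theorem bell_kochen_specker (d : ℕ) (hd : 3 ≤ d)
    (Λ : Type*) [MeasurableSpace Λ] [Nonempty Λ] :
    ¬ ∃ ε : Matrix (Fin d) (Fin d) ℂ → Λ → ℝ,
      (∀ O : Matrix (Fin d) (Fin d) ℂ, O.IsHermitian → Measurable (ε O)) ∧
      (∀ (O : Matrix (Fin d) (Fin d) ℂ) (hO : O.IsHermitian) (g : ℝ → ℝ),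
        ε (hO.cfc g) = g ∘ ε O) := by
  rintro ⟨ε, -, hε⟩
  obtain ⟨x⟩ := ‹Nonempty Λ›
  have hw (O : Matrix (Fin d) (Fin d) ℂ) (hO : IsSelfAdjoint O) (q : Polynomial ℝ) :
      ε (Polynomial.aeval O q) x = q.eval (ε O x) := by
    have hO' : O.IsHermitian := hO
    rw [← cfc_polynomial q O hO, hO'.cfc_eq, hε O hO']
    rfl
  refine (isProjectionValuation_of_aeval (w := fun O ↦ ε O x) hw).map_one_ne_one hd ?_
  simpa using hw 0 (.zero _) 1
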